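/- A graph G is dominating if and only if G contains a uniform subdivision of T_ω, or contains 𝔟 pairwise disjoint subdivisions of T_ω, or contains 𝔡 pairwise disjoint rays. -/

import Mathlib

open Filter Cardinal

/-- `f` is eventually dominated by `g`: `f n ≤ g n` for all but finitely many `n`. -/
def EvDom (f g : ℕ → ℕ) : Prop := ∀ᶠ n in Filter.atTop, f n ≤ g n

/-- A ray in `G`: an injective one-way infinite path. -/
def IsRay {X : Type} (G : SimpleGraph X) (R : ℕ → X) : Prop :=
  Function.Injective R ∧ ∀ n, G.Adj (R n) (R (n + 1))

/-- A graph is dominating if some labelling makes the labels along rays a dominating family. -/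
def DominatingGraph {X : Type} (G : SimpleGraph X) : Prop :=
  ∃ L : X → ℕ, ∀ f : ℕ → ℕ, ∃ R : ℕ → X, IsRay G R ∧ EvDom f (L ∘ R)

/-- `F` is a dominating family of functions. -/
def DomFamily (F : Set (ℕ → ℕ)) : Prop := ∀ g : ℕ → ℕ, ∃ f ∈ F, EvDom g f

/-- `F` is a bounded family of functions. -/
def BddFamily (F : Set (ℕ → ℕ)) : Prop := ∃ g : ℕ → ℕ, ∀ f ∈ F, EvDom f g

/-- The dominating number 𝔡. -/
noncomputable def dNum : Cardinal := sInf {c | ∃ F : Set (ℕ → ℕ), DomFamily F ∧ #F = c}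

/-- The bounding number 𝔟. -/
noncomputable def bNum : Cardinal := sInf {c | ∃ F : Set (ℕ → ℕ), ¬ BddFamily F ∧ #F = c}

/-- A branch vertex: one of countably infinite degree. -/
def BranchVtx {X : Type} (T : SimpleGraph X) (v : X) : Prop := #(T.neighborSet v) = ℵ₀

/-- `T` is a copy of `T_ω`: a tree all of whose vertices have countably infinite degree. -/
def IsTOmega {X : Type} (T : SimpleGraph X) : Prop :=
  T.IsTree ∧ ∀ v, BranchVtx T v

/-- `T` is a subdivision of `T_ω`: a tree with all degrees 2 or ℵ₀ in which every ray
meets a branch vertex. -/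
def IsSubdivTOmega {X : Type} (T : SimpleGraph X) : Prop :=
  T.IsTree ∧ (∀ v, #(T.neighborSet v) = 2 ∨ BranchVtx T v) ∧
    ∀ R : ℕ → X, IsRay T R → ∃ n, BranchVtx T (R n)

/-- `W` is a subdivided edge of `T` (from a branch vertex to a branch vertex, with
no branch vertices in its interior). -/
def SubdividedEdge {X : Type} (T : SimpleGraph X) {x y : X} (W : T.Walk x y) : Prop :=
  W.IsPath ∧ BranchVtx T x ∧ BranchVtx T y ∧ 0 < W.length ∧
    ∀ v ∈ W.support, v ≠ x → v ≠ y → ¬ BranchVtx T v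

/-- `T` is a uniform subdivision of `T_ω`: it has a root `r` such that at every branch
vertex `x`, all subdivided edges at `x` not towards `r` have the same length. -/
def UniformSubdivTOmega {X : Type} (T : SimpleGraph X) : Prop :=
  IsSubdivTOmega T ∧ ∃ r : X, BranchVtx T r ∧
    ∀ (x y z : X) (W : T.Walk x y) (W' : T.Walk x z),
      SubdividedEdge T W → SubdividedEdge T W' →
      (∀ P : T.Walk x r, P.IsPath → y ∉ P.support) →
      (∀ P : T.Walk x r, P.IsPath → z ∉ P.support) →
      W.length = W'.length

/-- `Ps` is a family of disjoint paths starting at `x`: each member is a path from `x`,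
and distinct members share no vertex other than `x`. -/
def DisjPathFam {X : Type} (G : SimpleGraph X) (x : X)
    (Ps : Set (Σ y : X, G.Walk x y)) : Prop :=
  (∀ P ∈ Ps, Sigma.snd P |>.IsPath) ∧
    ∀ P ∈ Ps, ∀ Q ∈ Ps, P ≠ Q →
      ∀ v, v ∈ (Sigma.snd P).support → v ∈ (Sigma.snd Q).support → v = x

/-- The first `ℓ + 1` values of `p` form a path in `G`. -/
def IsPathFn {X : Type} (G : SimpleGraph X) (p : ℕ → X) (ℓ : ℕ) : Prop :=
  Set.InjOn p (Set.Iic ℓ) ∧ ∀ i < ℓ, G.Adj (p i) (p (i + 1))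

/-- No finite set separates `x` from `W` with respect to the nontrivial paths whose length
lies in `D`. -/
def Escapes {X : Type} (G : SimpleGraph X) (D : Set ℕ) (W : Set X) (x : X) : Prop :=
  ∀ S : Finset X, ∃ p ℓ, 0 < ℓ ∧ ℓ ∈ D ∧ IsPathFn G p ℓ ∧ p 0 = x ∧ p ℓ ∈ W ∧
    ∀ i, 0 < i → i ≤ ℓ → p i ∉ S

lemma IsRay.isPathFn_add {X : Type} {G : SimpleGraph X} {R : ℕ → X} (hR : IsRay G R)
    (n ℓ : ℕ) : IsPathFn G (fun i => R (n + i)) ℓ :=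
  ⟨fun _ _ _ _ h => Nat.add_left_cancel (hR.1 h), fun i _ => hR.2 (n + i)⟩

lemma IsRay.comp_add {X : Type} {G : SimpleGraph X} {R : ℕ → X} (hR : IsRay G R) (n : ℕ) :
    IsRay G (fun i => R (n + i)) :=
  ⟨fun _ _ h => Nat.add_left_cancel (hR.1 h), fun i => hR.2 (n + i)⟩

/-- The transfinite derivative of the whole space along `Φ`. -/
def transfiniteDerivative {X : Type} (Φ : Set X → Set X) (α : Ordinal.{0}) : Set X :=
  {x | ∀ β, β < α → x ∈ Φ (transfiniteDerivative Φ β)}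
termination_by α

lemma mem_transfiniteDerivative {X : Type} {Φ : Set X → Set X} {α : Ordinal.{0}} {x : X} :
    x ∈ transfiniteDerivative Φ α ↔ ∀ β, β < α → x ∈ Φ (transfiniteDerivative Φ β) := by
  rw [transfiniteDerivative]; rfl

lemma exists_rank {X : Type} (Φ : Set X → Set X) (h : ∀ W, W ⊆ Φ W → W = ∅) :
    ∃ ρ : X → Ordinal.{0}, ∀ x, x ∉ Φ {y | ρ x ≤ ρ y} := by
  have key : ∃ α, transfiniteDerivative Φ α = ∅ := by
    by_contra! hne
    have h1 : ∀ α, ∃ x, x ∈ transfiniteDerivative Φ α ∧ x ∉ Φ (transfiniteDerivative Φ α) := by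
      intro α
      by_contra! hc
      exact (hne α).ne_empty (h _ hc)
    choose x hx hx' using h1
    refine not_injective_of_ordinal x fun α β hαβ => ?_
    rcases lt_trichotomy α β with hlt | heq | hlt
    · exact absurd (hαβ ▸ mem_transfiniteDerivative.1 (hx β) α hlt) (hx' α)
    · exact heq
    · exact absurd (hαβ ▸ mem_transfiniteDerivative.1 (hx α) β hlt) (hx' β)
  obtain ⟨α, hα⟩ := key
  have h1 : ∀ x, ∃ β, x ∉ Φ (transfiniteDerivative Φ β) := by
    intro x
    by_contra! hc
    have : x ∈ transfiniteDerivative Φ α := mem_transfiniteDerivative.2 fun β _ => hc β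
    simp [hα] at this
  refine ⟨fun x => sInf {β | x ∉ Φ (transfiniteDerivative Φ β)}, fun x => ?_⟩
  have h2 : x ∉ Φ (transfiniteDerivative Φ (sInf {β | x ∉ Φ (transfiniteDerivative Φ β)})) :=
    csInf_mem (s := {β | x ∉ Φ (transfiniteDerivative Φ β)}) (h1 x)
  have h3 : transfiniteDerivative Φ (sInf {β | x ∉ Φ (transfiniteDerivative Φ β)}) =
      {y | sInf {β | x ∉ Φ (transfiniteDerivative Φ β)} ≤
        sInf {β | y ∉ Φ (transfiniteDerivative Φ β)}} := by
    ext y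
    rw [mem_transfiniteDerivative, Set.mem_ofPred_eq]
    constructor
    · intro hall
      refine le_csInf (h1 y) fun β hβ => ?_
      by_contra hc
      exact hβ (hall β (not_le.1 hc))
    · intro hle β hβ
      by_contra hc
      exact absurd (hβ.trans_le hle) (not_lt.2 (csInf_le' hc))
  rwa [h3] at h2

/-- A sequence of ordinals has records arbitrarily late, relative to any late starting point. -/
lemma exists_records (a : ℕ → Ordinal.{0}) :
    ∃ n, ∀ n' ≥ n, ∀ N, ∃ m ≥ N, n' < m ∧ ∀ j, n' ≤ j → j < m → a j ≤ a m := by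
  have hne : {α : Ordinal.{0} | ∃ n, ∀ j ≥ n, a j < α}.Nonempty := by
    obtain ⟨b, hb⟩ := Ordinal.bddAbove_of_small (s := Set.range a)
    exact ⟨Order.succ b, 0, fun j _ => Order.lt_succ_of_le (hb ⟨j, rfl⟩)⟩
  obtain ⟨n, hn⟩ := csInf_mem hne
  set α := sInf {α : Ordinal.{0} | ∃ n, ∀ j ≥ n, a j < α} with hα
  refine ⟨n, fun n' hn' N => ?_⟩
  obtain ⟨k, hk, hkmax⟩ := Finset.exists_max_image (Finset.Icc n' (max n' N)) a
    ⟨n', by simp⟩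
  have hkα : a k < α := hn k (hn'.trans (Finset.mem_Icc.1 hk).1)
  have h1 : ∃ m, max n' N < m ∧ a k ≤ a m := by
    by_contra! hc
    have : α ≤ a k := csInf_le' ⟨max n' N + 1, fun j hj => hc j hj⟩
    exact absurd hkα (not_lt.2 this)
  classical
  obtain ⟨hm1, hm2⟩ := Nat.find_spec h1
  refine ⟨Nat.find h1, ?_, ?_, fun j hj hjm => ?_⟩
  · exact (le_max_right _ _).trans hm1.le
  · exact (le_max_left _ _).trans_lt hm1
  · by_cases hjN : j ≤ max n' N
    · exact (hkmax j (Finset.mem_Icc.2 ⟨hj, hjN⟩)).trans hm2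
    · have := Nat.find_min h1 hjm
      push Not at this
      exact (this (not_le.1 hjN)).le.trans hm2

/-- If every vertex can be finitely separated from the vertices of no smaller rank, then the
records at distance `ℓ` from a given vertex form a finite set. -/
lemma exists_finset_records {X : Type} (G : SimpleGraph X) (ρ : X → Ordinal.{0})
    (h : ∀ x ℓ, ¬ Escapes G {ℓ} {y | ρ x ≤ ρ y} x) (ℓ : ℕ) :
    ∀ x, ∃ B : Finset X, ∀ p, IsPathFn G p ℓ → p 0 = x →
      (∀ j < ℓ, ρ (p j) ≤ ρ (p ℓ)) → p ℓ ∈ B := by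
  classical
  induction ℓ using Nat.strong_induction_on with
  | _ ℓ ih =>
  intro x
  rcases Nat.eq_zero_or_pos ℓ with rfl | hℓ
  · exact ⟨{x}, fun p _ hp _ => by simp [hp]⟩
  have := h x ℓ
  unfold Escapes at this
  push Not at this
  obtain ⟨S, hS⟩ := this
  choose! B hB using ih
  refine ⟨S ∪ (Finset.range ℓ).biUnion fun j => S.biUnion fun y => B j y,
    fun p hp hp0 hrec => ?_⟩
  obtain ⟨i, hi0, hiℓ, hiS⟩ := hS p ℓ hℓ rfl hp hp0 (by simpa [hp0] using hrec 0 hℓ)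
  rcases hiℓ.eq_or_lt with rfl | hlt
  · exact Finset.mem_union_left _ hiS
  · refine Finset.mem_union_right _ (Finset.mem_biUnion.2 ⟨ℓ - i, by simp; omega,
      Finset.mem_biUnion.2 ⟨p i, hiS, ?_⟩⟩)
    have := hB (ℓ - i) (by omega) (p i) (fun j => p (i + j)) ?_ rfl ?_
    · simpa [Nat.add_sub_of_le hiℓ] using this
    · refine ⟨fun a ha b hb hab => ?_, fun j hj => hp.2 (i + j) (by omega)⟩
      simp only [Set.mem_Iic] at ha hb
      exact Nat.add_left_cancel (hp.1 (by simp; omega) (by simp; omega) hab)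
    · intro j hj
      simpa [Nat.add_sub_of_le hiℓ] using hrec (i + j) (by omega)

lemma bddFamily_of_lt {F : Set (ℕ → ℕ)} (h : #F < bNum) : BddFamily F := by
  by_contra hc
  exact absurd h (not_lt.2 (csInf_le' ⟨F, hc, rfl⟩))

lemma not_domFamily_of_lt {F : Set (ℕ → ℕ)} (h : #F < dNum) : ¬ DomFamily F := fun hc =>
  absurd h (not_lt.2 (csInf_le' ⟨F, hc, rfl⟩))

lemma exists_not_bddFamily : ∃ F : Set (ℕ → ℕ), ¬ BddFamily F ∧ #F = bNum := by
  refine csInf_mem (s := {c | ∃ F : Set (ℕ → ℕ), ¬ BddFamily F ∧ #F = c}) ⟨_, Set.univ, ?_, rfl⟩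
  rintro ⟨g, hg⟩
  obtain ⟨n, hn⟩ := (hg (fun n => g n + 1) trivial).exists
  exact absurd hn (Nat.not_succ_le_self _)

lemma exists_domFamily : ∃ F : Set (ℕ → ℕ), DomFamily F ∧ #F = dNum :=
  csInf_mem (s := {c | ∃ F : Set (ℕ → ℕ), DomFamily F ∧ #F = c})
    ⟨_, Set.univ, fun g => ⟨g, trivial, Eventually.of_forall fun _ => le_rfl⟩, rfl⟩

lemma bddFamily_of_countable {F : Set (ℕ → ℕ)} (h : F.Countable) : BddFamily F := by
  rcases F.eq_empty_or_nonempty with rfl | hne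
  · exact ⟨0, by simp⟩
  obtain ⟨e, rfl⟩ := h.exists_eq_range hne
  refine ⟨fun n => ∑ i ∈ Finset.range (n + 1), e i n, ?_⟩
  rintro _ ⟨i, rfl⟩
  filter_upwards [eventually_ge_atTop i] with n hn
  exact Finset.single_le_sum (f := fun i => e i n) (fun _ _ => Nat.zero_le _)
    (Finset.mem_range.2 (by omega))

lemma aleph0_lt_bNum : ℵ₀ < bNum := by
  obtain ⟨F, hF, hc⟩ := exists_not_bddFamily
  rw [← hc]
  by_contra hle
  exact hF (bddFamily_of_countable (Cardinal.le_aleph0_iff_set_countable.1 (not_lt.1 hle)))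

lemma aleph0_lt_dNum : ℵ₀ < dNum := by
  obtain ⟨F, hF, hc⟩ := exists_domFamily
  rw [← hc]
  by_contra hle
  obtain ⟨g, hg⟩ :=
    bddFamily_of_countable (Cardinal.le_aleph0_iff_set_countable.1 (not_lt.1 hle))
  obtain ⟨f, hf, hgf⟩ := hF fun n => g n + 1
  obtain ⟨n, hn1, hn2⟩ := ((hg f hf).and hgf).exists
  exact absurd (hn2.trans hn1) (Nat.not_succ_le_self _)

/-- Rays whose labels dominate a suitable function leave any set of fewer than `𝔟` vertices,
in a graph whose vertices are ranked with respect to fans of paths of constant length. -/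
lemma exists_forcing_finite_inter {X : Type} (G : SimpleGraph X) (ρ : X → Ordinal.{0})
    (h : ∀ x ℓ, ¬ Escapes G {ℓ} {y | ρ x ≤ ρ y} x) (L : X → ℕ) (U : Set X) (hU : #U < bNum) :
    ∃ f₀ : ℕ → ℕ, ∀ R, IsRay G R → EvDom (fun n => f₀ n + 1) (L ∘ R) →
      ∃ n₀, ∀ n ≥ n₀, R n ∉ U := by
  choose B hB using exists_finset_records G ρ h
  let F : X → ℕ → ℕ := fun x m => ∑ ℓ ∈ Finset.range (m + 1), ∑ y ∈ B ℓ x, L y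
  obtain ⟨f₀, hf₀⟩ := bddFamily_of_lt (F := F '' U) (mk_image_le.trans_lt hU)
  refine ⟨f₀, fun R hR hdom => ?_⟩
  by_contra! hinf
  obtain ⟨n, hn⟩ := exists_records fun i => ρ (R i)
  obtain ⟨n', hn', hx⟩ := hinf n
  obtain ⟨N, hN⟩ := ((hf₀ _ ⟨R n', hx, rfl⟩).and hdom).exists_forall_of_atTop
  obtain ⟨m, hmN, hlt, hrec⟩ := hn n' hn' N
  obtain ⟨h1, h2⟩ := hN m hmN
  have hmem : R m ∈ B (m - n') (R n') := by
    have := hB (m - n') (R n') (fun i => R (n' + i)) (hR.isPathFn_add _ _) rfl ?_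
    · simpa [Nat.add_sub_of_le hlt.le] using this
    · intro j hj
      simpa [Nat.add_sub_of_le hlt.le] using hrec (n' + j) (by omega) (by omega)
  have h3 : L (R m) ≤ F (R n') m := by
    calc L (R m) ≤ ∑ y ∈ B (m - n') (R n'), L y :=
          Finset.single_le_sum (f := L) (fun _ _ => Nat.zero_le _) hmem
      _ ≤ F (R n') m := Finset.single_le_sum (f := fun ℓ => ∑ y ∈ B ℓ (R n'), L y)
          (fun _ _ => Nat.zero_le _) (Finset.mem_range.2 (by omega))
  simp only [Function.comp] at h2
  omega

/-- A graph whose vertices are ranked with respect to fans, and in which fewer than `𝔡`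
vertices meet all rays, is not dominating. -/
lemma exists_not_dominated {X : Type} (G : SimpleGraph X) (ρ : X → Ordinal.{0})
    (h : ∀ x, ¬ Escapes G Set.univ {y | ρ x ≤ ρ y} x) (L : X → ℕ) (U : Set X) (hU : #U < dNum)
    (hmeet : ∀ R, IsRay G R → ∃ n, R n ∈ U) :
    ∃ f₁ : ℕ → ℕ, ∀ f, Monotone f → (∀ n, f₁ n ≤ f n) → ∀ R, IsRay G R → ¬ EvDom f (L ∘ R) := by
  classical
  unfold Escapes at h
  push Not at h
  choose S hS using h
  let A : X → ℕ → Finset X := fun x k => k.rec {x} fun _ s => s.biUnion S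
  let F : X → ℕ → ℕ := fun x k => ∑ y ∈ A x k, L y
  have := not_domFamily_of_lt (F := F '' U) (mk_image_le.trans_lt hU)
  unfold DomFamily at this
  push Not at this
  obtain ⟨f₁, hf₁⟩ := this
  refine ⟨f₁, fun f hmono hle R hR hdom => ?_⟩
  obtain ⟨n, hn⟩ := exists_records fun i => ρ (R i)
  obtain ⟨i, hi⟩ := hmeet _ (hR.comp_add n)
  have key : ∀ k, ∃ j, n + i + k ≤ j ∧ R j ∈ A (R (n + i)) k := by
    intro k
    induction k with
    | zero => exact ⟨n + i, le_rfl, Finset.mem_singleton_self _⟩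
    | succ k ih =>
      obtain ⟨j, hj, hjA⟩ := ih
      obtain ⟨m, -, hlt, hrec⟩ := hn j (by omega) 0
      obtain ⟨t, ht0, -, htS⟩ := hS (R j) (fun t => R (j + t)) (m - j) (by omega) trivial
        (hR.isPathFn_add _ _) rfl
        (by simpa [Nat.add_sub_of_le hlt.le] using hrec j le_rfl hlt)
      exact ⟨j + t, by omega, Finset.mem_biUnion.2 ⟨R j, hjA, htS⟩⟩
  refine hf₁ _ ⟨R (n + i), hi, rfl⟩ ?_
  obtain ⟨N, hN⟩ := hdom.exists_forall_of_atTop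
  filter_upwards [eventually_ge_atTop N] with k hk
  obtain ⟨j, hj, hjA⟩ := key k
  calc f₁ k ≤ f k := hle k
    _ ≤ f j := hmono (by omega)
    _ ≤ L (R j) := hN j (by omega)
    _ ≤ F (R (n + i)) k := Finset.single_le_sum (f := L) (fun _ _ => Nat.zero_le _) hjA

/-- Either there are `κ` disjoint sets with property `P`, or fewer than `κ` points meet all
sets with property `P`. -/
lemma exists_disjoint_or_hitting {X : Type} (P : Set X → Prop) (hne : ∀ A, P A → A.Nonempty)
    (hct : ∀ A, P A → A.Countable) (κ : Cardinal.{0}) (hκ : ℵ₀ < κ) :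
    (∃ (ι : Type) (_ : #ι = κ) (H : ι → Set X),
      Pairwise (Function.onFun Disjoint H) ∧ ∀ i, P (H i)) ∨
    ∃ U : Set X, #U < κ ∧ ∀ A, P A → (A ∩ U).Nonempty := by
  obtain ⟨𝒜, h𝒜⟩ := zorn_subset {𝒜 : Set (Set X) | (∀ A ∈ 𝒜, P A) ∧ 𝒜.PairwiseDisjoint id} (by
    intro c hc hchain
    refine ⟨⋃₀ c, ⟨?_, ?_⟩, fun s hs => Set.subset_sUnion_of_mem hs⟩
    · rintro A ⟨s, hs, hA⟩
      exact (hc hs).1 A hA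
    · exact (Set.pairwiseDisjoint_sUnion hchain.directedOn).2 fun s hs => (hc hs).2)
  by_cases hcard : κ ≤ #𝒜
  · left
    obtain ⟨p, hp, hpκ⟩ := Cardinal.le_mk_iff_exists_subset.1 hcard
    exact ⟨p, hpκ, fun A => A, fun A B hAB => h𝒜.1.2 (hp A.2) (hp B.2)
      (fun h => hAB (Subtype.ext h)), fun A => h𝒜.1.1 _ (hp A.2)⟩
  · right
    refine ⟨⋃₀ 𝒜, ?_, fun A hA => ?_⟩
    · refine (Cardinal.mk_sUnion_le 𝒜).trans_lt ?_
      refine Cardinal.mul_lt_of_lt hκ.le (not_le.1 hcard) (lt_of_le_of_lt ?_ hκ)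
      exact ciSup_le' fun A => Cardinal.le_aleph0_iff_set_countable.2 (hct _ (h𝒜.1.1 _ A.2))
    · by_contra hdisj
      rw [Set.not_nonempty_iff_eq_empty] at hdisj
      have hA' : ∀ B ∈ 𝒜, Disjoint A B := fun B hB =>
        (Set.disjoint_iff_inter_eq_empty.2 hdisj).mono_right (Set.subset_sUnion_of_mem hB)
      have hins : insert A 𝒜 ⊆ 𝒜 := h𝒜.2 (y := insert A 𝒜)
        ⟨fun B hB => hB.elim (fun h => h ▸ hA) (h𝒜.1.1 B),
          h𝒜.1.2.insert fun B hB _ => hA' B hB⟩ (Set.subset_insert _ _)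
      have := hA' A (hins (Set.mem_insert _ _))
      exact (hne A hA).ne_empty (disjoint_self.1 this)

/-- A rooted tree presented by a parent function and a depth function. -/
structure ParentTree (V : Type) where
  root : V
  parent : V → V
  depth : V → ℕ
  depth_root : depth root = 0
  depth_parent : ∀ v, v ≠ root → depth v = depth (parent v) + 1

namespace ParentTree

variable {V : Type} (D : ParentTree V)

/-- `c` is a child of `v`. -/
def IsChild (c v : V) : Prop := c ≠ D.root ∧ D.parent c = v

/-- The tree as a graph. -/
def graph : SimpleGraph V where
  Adj u v := D.IsChild u v ∨ D.IsChild v u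
  symm := ⟨fun _ _ => Or.symm⟩
  loopless := ⟨fun v h => by
    have h1 : D.IsChild v v := h.elim id id
    have := D.depth_parent v h1.1
    rw [h1.2] at this
    omega⟩

variable {D}

lemma IsChild.depth {c v : V} (h : D.IsChild c v) : D.depth c = D.depth v + 1 := by
  rw [D.depth_parent c h.1, h.2]

lemma IsChild.adj {c v : V} (h : D.IsChild c v) : D.graph.Adj v c := Or.inr h

lemma isChild_parent {v : V} (h : v ≠ D.root) : D.IsChild v (D.parent v) := ⟨h, rfl⟩

lemma IsChild.unique {c v w : V} (h : D.IsChild c v) (h' : D.IsChild c w) : v = w :=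
  h.2.symm.trans h'.2

lemma isChild_of_adj_of_depth_le {u v : V} (h : D.graph.Adj u v) (hd : D.depth u ≤ D.depth v) :
    D.IsChild v u := by
  rcases h with h | h
  · have := h.depth
    omega
  · exact h

variable (D)

lemma reachable_root (v : V) : D.graph.Reachable v D.root := by
  induction hn : D.depth v using Nat.strong_induction_on generalizing v with
  | _ n ih =>
  by_cases h : v = D.root
  · rw [h]
  · have hc := isChild_parent h
    exact (SimpleGraph.Adj.reachable hc.adj.symm).trans
      (ih (D.depth (D.parent v)) (by have := hc.depth; omega) _ rfl)

lemma isTree : D.graph.IsTree := by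
  classical
  refine ⟨?_, fun v c hc => ?_⟩
  · have : Nonempty V := ⟨D.root⟩
    exact ⟨fun u v => (D.reachable_root u).trans (D.reachable_root v).symm⟩
  · obtain ⟨u, hu, hmax⟩ := Finset.exists_max_image c.support.toFinset D.depth ⟨v, by simp⟩
    rw [List.mem_toFinset] at hu
    have hc' : (c.rotate u hu).IsCycle := (SimpleGraph.Walk.isCycle_rotate hu).2 hc
    have hnn : ¬ (c.rotate u hu).Nil := hc'.not_nil
    have hle : ∀ w ∈ (c.rotate u hu).support, D.depth w ≤ D.depth u := by
      intro w hw
      refine hmax w ?_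
      rw [List.mem_toFinset]
      exact (SimpleGraph.Walk.mem_support_rotate_iff c u hu).1 hw
    have h1 := isChild_of_adj_of_depth_le ((c.rotate u hu).adj_snd hnn).symm
      (hle _ ((c.rotate u hu).getVert_mem_support _))
    have h2 := isChild_of_adj_of_depth_le ((c.rotate u hu).adj_penultimate hnn)
      (hle _ ((c.rotate u hu).getVert_mem_support _))
    exact hc'.snd_ne_penultimate (h1.unique h2)

end ParentTree

/-- Every tree with a chosen root has a parent function. -/
lemma exists_parentTree {V : Type} {T : SimpleGraph V} (hT : T.IsTree) (r : V) :
    ∃ D : ParentTree V, D.graph = T ∧ D.root = r ∧ ∀ v, D.depth v = T.dist r v := by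
  have h1 : ∀ v, ∃ w, v ≠ r → T.Adj w v ∧ T.dist r v = T.dist r w + 1 := by
    intro v
    by_cases hv : v = r
    · exact ⟨v, fun h => absurd hv h⟩
    obtain ⟨p, hp, hl⟩ := hT.1.exists_path_of_dist r v
    have hnn : ¬ p.Nil := SimpleGraph.Walk.not_nil_of_ne (Ne.symm hv)
    refine ⟨p.penultimate, fun _ => ⟨p.adj_penultimate hnn, ?_⟩⟩
    have h2 := SimpleGraph.dist_le p.dropLast
    have h3 : p.dropLast.length + 1 = p.length := SimpleGraph.Walk.length_dropLast_add_one hnn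
    have h4 := hT.dist_eq_dist_add_one_of_adj r (p.adj_penultimate hnn)
    omega
  choose par hpar using h1
  have huniq : ∀ u v, T.Adj u v → T.dist r v = T.dist r u + 1 → v ≠ r ∧ par v = u := by
    intro u v huv hd
    have hv : v ≠ r := by
      rintro rfl
      simp at hd
    refine ⟨hv, ?_⟩
    obtain ⟨p, hp, hl⟩ := hT.1.exists_path_of_dist r u
    obtain ⟨q, hq, hl'⟩ := hT.1.exists_path_of_dist r (par v)
    have e1 := (p.concat huv).isPath_of_length_eq_dist (by simp [hl, hd])
    have e2 := (q.concat (hpar v hv).1).isPath_of_length_eq_dist (by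
      rw [SimpleGraph.Walk.length_concat, hl', (hpar v hv).2])
    have e3 := (hT.existsUnique_path r v).unique e1 e2
    exact (SimpleGraph.Walk.concat_inj e3).1.symm
  refine ⟨⟨r, par, T.dist r, SimpleGraph.dist_self, fun v hv => (hpar v hv).2⟩, ?_, rfl,
    fun _ => rfl⟩
  ext u v
  constructor
  · rintro (⟨h, rfl⟩ | ⟨h, rfl⟩)
    · exact (hpar u h).1.symm
    · exact (hpar v h).1
  · intro h
    rcases hT.dist_eq_dist_add_one_of_adj r h with hd | hd
    · exact Or.inl (huniq v u h.symm hd)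
    · exact Or.inr (huniq u v h hd)

lemma SimpleGraph.Walk.IsPath.isPathFn {X : Type} {G : SimpleGraph X} {x y : X} {W : G.Walk x y}
    (hW : W.IsPath) : IsPathFn G W.getVert W.length :=
  ⟨hW.getVert_injOn, fun _ hi => W.adj_getVert_succ hi⟩

lemma IsPathFn.mono {X : Type} {G : SimpleGraph X} {p : ℕ → X} {ℓ ℓ' : ℕ} (h : IsPathFn G p ℓ)
    (hle : ℓ' ≤ ℓ) : IsPathFn G p ℓ' :=
  ⟨h.1.mono (Set.Iic_subset_Iic.2 hle), fun i hi => h.2 i (hi.trans_le hle)⟩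

lemma IsPathFn.exists_walk {X : Type} {G : SimpleGraph X} {p : ℕ → X} {ℓ : ℕ}
    (h : IsPathFn G p ℓ) :
    ∃ W : G.Walk (p 0) (p ℓ), W.IsPath ∧ W.length = ℓ ∧ ∀ v ∈ W.support, ∃ i ≤ ℓ, v = p i := by
  induction ℓ with
  | zero => exact ⟨.nil, by simp, rfl, fun v hv => ⟨0, le_rfl, by simpa using hv⟩⟩
  | succ ℓ ih =>
    obtain ⟨W, hW, hl, hs⟩ := ih (h.mono ℓ.le_succ)
    refine ⟨W.concat (h.2 ℓ ℓ.lt_succ_self), hW.concat (fun hmem => ?_) _, by simp [hl], ?_⟩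
    · obtain ⟨i, hi, he⟩ := hs _ hmem
      have := h.1 (by simp) (by simp; omega) he
      omega
    · intro v hv
      rw [SimpleGraph.Walk.support_concat, List.mem_append, List.mem_singleton] at hv
      rcases hv with hv | rfl
      · obtain ⟨i, hi, he⟩ := hs v hv
        exact ⟨i, by omega, he⟩
      · exact ⟨ℓ + 1, le_rfl, rfl⟩

namespace ParentTree

variable {V : Type} {D : ParentTree V}

lemma isChild_succ_of_isPathFn {w : ℕ → V} {ℓ i j : ℕ} (hw : IsPathFn D.graph w ℓ)
    (hi : D.IsChild (w (i + 1)) (w i)) (hij : i ≤ j) (hj : j < ℓ) :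
    D.IsChild (w (j + 1)) (w j) := by
  induction j, hij using Nat.le_induction with
  | base => exact hi
  | succ j hij ih =>
    have h1 := ih (by omega)
    rcases hw.2 (j + 1) hj with h2 | h2
    · have := hw.1 (by simp; omega) (by simp; omega) (h1.unique h2)
      omega
    · exact h2

lemma depth_of_isChild_succ {w : ℕ → V} {i n : ℕ}
    (h : ∀ j, i ≤ j → j < i + n → D.IsChild (w (j + 1)) (w j)) :
    D.depth (w (i + n)) = D.depth (w i) + n := by
  induction n with
  | zero => rfl
  | succ n ih =>
    have h1 := (h (i + n) (by omega) (by omega)).depth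
    have h2 := ih fun j h1 h2 => h j h1 (by omega)
    rw [← add_assoc, h1]
    omega

lemma isChild_of_isPath_root {x : V} {P : D.graph.Walk x D.root} (hP : P.IsPath) {j : ℕ}
    (hj : j < P.length) : D.IsChild (P.getVert j) (P.getVert (j + 1)) := by
  rcases hP.isPathFn.2 j hj with h | h
  · exact h
  · have := isChild_succ_of_isPathFn hP.isPathFn h (j := P.length - 1) (by omega) (by omega)
    rw [Nat.sub_add_cancel (by omega), P.getVert_length] at this
    exact absurd rfl this.1

lemma depth_le_of_mem_support {x v : V} {P : D.graph.Walk x D.root} (hP : P.IsPath)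
    (hv : v ∈ P.support) : D.depth v ≤ D.depth x := by
  obtain ⟨n, rfl, hn⟩ := SimpleGraph.Walk.mem_support_iff_exists_getVert.1 hv
  clear hv
  induction n with
  | zero => simp
  | succ n ih =>
    have h1 := ih (by omega)
    have h2 := (isChild_of_isPath_root hP (j := n) (by omega)).depth
    omega

lemma IsChild.mem_support {x c v : V} (h : D.IsChild c v) {P : D.graph.Walk x D.root}
    (hP : P.IsPath) (hc : c ∈ P.support) : v ∈ P.support := by
  obtain ⟨n, rfl, hn⟩ := SimpleGraph.Walk.mem_support_iff_exists_getVert.1 hc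
  have hlt : n < P.length := by
    refine hn.lt_of_ne ?_
    rintro rfl
    exact h.1 P.getVert_length
  rw [h.unique (isChild_of_isPath_root hP hlt)]
  exact P.getVert_mem_support _

lemma isRay_of_isChild {w : ℕ → V} (h : ∀ n, D.IsChild (w (n + 1)) (w n)) :
    IsRay D.graph w := by
  refine ⟨fun a b hab => ?_, fun n => (h n).adj⟩
  have h1 := depth_of_isChild_succ (i := 0) (n := a) fun j _ _ => h j
  have h2 := depth_of_isChild_succ (i := 0) (n := b) fun j _ _ => h j
  rw [zero_add] at h1 h2
  rw [hab] at h1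
  omega

/-- `B` is the set of branch vertices of a subdivision of `T_ω` rooted at a branch vertex, and
`halt v` is the depth of the first branch vertex in the tree order above `v`. -/
structure IsBranching (D : ParentTree V) (B : Set V) (halt : V → ℕ) : Prop where
  root_mem : D.root ∈ B
  existsUnique_child : ∀ v, v ∉ B → ∃! c, D.IsChild c v
  infinite_children : ∀ v ∈ B, {c | D.IsChild c v}.Infinite
  halt_child : ∀ c v, D.IsChild c v → v ∉ B → halt c = halt v
  depth_le_halt : ∀ v, D.depth v ≤ halt v
  halt_of_mem : ∀ v ∈ B, halt v = D.depth v

variable {B : Set V} {halt : V → ℕ}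

lemma neighborSet_eq (v : V) :
    D.graph.neighborSet v = {c | D.IsChild c v} ∪ {u | D.IsChild v u} := by
  ext u
  exact or_comm

lemma IsBranching.card_of_notMem (h : IsBranching D B halt) {v : V} (hv : v ∉ B) :
    #(D.graph.neighborSet v) = 2 := by
  obtain ⟨c, hc, hu⟩ := h.existsUnique_child v hv
  have hr : v ≠ D.root := fun hr => hv (hr ▸ h.root_mem)
  have hp := isChild_parent hr
  have : D.graph.neighborSet v = {c, D.parent v} := by
    rw [neighborSet_eq]
    ext u
    constructor
    · rintro (hu' | hu')
      · exact Or.inl (hu u hu')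
      · exact Or.inr (hu'.unique hp)
    · rintro (rfl | rfl)
      · exact Or.inl hc
      · exact Or.inr hp
  rw [this, Cardinal.mk_insert, Cardinal.mk_singleton]
  · norm_num
  · rintro rfl
    have h1 := hc.depth
    have h2 := hp.depth
    omega

lemma IsBranching.branchVtx_iff [Countable V] (h : IsBranching D B halt) {v : V} :
    BranchVtx D.graph v ↔ v ∈ B := by
  constructor
  · intro hb
    by_contra hv
    have h2 := h.card_of_notMem hv
    rw [BranchVtx, h2] at hb
    exact (Cardinal.natCast_lt_aleph0 (n := 2)).ne (by exact_mod_cast hb)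
  · intro hv
    refine le_antisymm (Cardinal.mk_le_aleph0) ?_
    rw [← Cardinal.infinite_iff, Set.infinite_coe_iff, neighborSet_eq]
    exact (h.infinite_children v hv).mono Set.subset_union_left

lemma IsBranching.halt_eq (h : IsBranching D B halt) {w : ℕ → V} {i n : ℕ}
    (hw : ∀ j, i ≤ j → j < i + n → D.IsChild (w (j + 1)) (w j))
    (hB : ∀ j, i ≤ j → j < i + n → w j ∉ B) : halt (w (i + n)) = halt (w i) := by
  induction n with
  | zero => rfl
  | succ n ih =>
    rw [← add_assoc, h.halt_child _ _ (hw (i + n) (by omega) (by omega))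
      (hB (i + n) (by omega) (by omega))]
    exact ih (fun j h1 h2 => hw j h1 (by omega)) (fun j h1 h2 => hB j h1 (by omega))

lemma IsBranching.isSubdivTOmega [Countable V] (h : IsBranching D B halt) :
    IsSubdivTOmega D.graph := by
  refine ⟨D.isTree, fun v => ?_, fun R hR => ?_⟩
  · by_cases hv : v ∈ B
    · exact Or.inr (h.branchVtx_iff.2 hv)
    · exact Or.inl (h.card_of_notMem hv)
  · simp_rw [h.branchVtx_iff]
    by_contra! hB
    have h1 : ∃ i, D.IsChild (R (i + 1)) (R i) := by
      by_contra! hc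
      have h2 : ∀ n, D.depth (R n) + n = D.depth (R 0) := by
        intro n
        induction n with
        | zero => rfl
        | succ n ih =>
          have := ((hR.2 n).resolve_right (hc n)).depth
          omega
      have := h2 (D.depth (R 0) + 1)
      omega
    obtain ⟨i, hi⟩ := h1
    have h2 : ∀ j, i ≤ j → D.IsChild (R (j + 1)) (R j) := fun j hj =>
      isChild_succ_of_isPathFn (ℓ := j + 1)
        ⟨hR.1.injOn, fun k _ => hR.2 k⟩ hi hj j.lt_succ_self
    have h3 := h.halt_eq (n := halt (R i) + 1) (fun j hj _ => h2 j hj) fun j _ _ => hB j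
    have h4 := depth_of_isChild_succ (n := halt (R i) + 1) (fun j hj _ => h2 j hj)
    have h5 := h.depth_le_halt (R (i + (halt (R i) + 1)))
    omega

lemma IsBranching.length_eq [Countable V] (h : IsBranching D B halt) {x y : V}
    {W : D.graph.Walk x y} (hW : SubdividedEdge D.graph W)
    (hy : ∀ P : D.graph.Walk x D.root, P.IsPath → y ∉ P.support) :
    ∃ c, D.IsChild c x ∧ D.depth x + W.length = halt c := by
  classical
  obtain ⟨hpath, hx, hyB, hpos, hint⟩ := hW
  have hfn := hpath.isPathFn
  simp_rw [h.branchVtx_iff] at hx hyB hint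
  have hint' : ∀ i, 0 < i → i < W.length → W.getVert i ∉ B := by
    intro i hi0 hil
    refine hint _ (W.getVert_mem_support i) (fun he => ?_) fun he => ?_
    · have := hfn.1 (by simp; omega) (by simp) (he.trans W.getVert_zero.symm)
      omega
    · have := hfn.1 (by simp; omega) (by simp) (he.trans W.getVert_length.symm)
      omega
  by_cases hex : ∃ i, i < W.length ∧ D.IsChild (W.getVert (i + 1)) (W.getVert i)
  · have hi := Nat.find_spec hex
    have hmin := fun j => Nat.find_min hex (m := j)
    set i := Nat.find hex
    rcases Nat.eq_zero_or_pos i with hi0 | hi0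
    · rw [hi0] at hi
      have hch : ∀ j, j < W.length → D.IsChild (W.getVert (j + 1)) (W.getVert j) := fun j hj =>
        isChild_succ_of_isPathFn hfn hi.2 (Nat.zero_le _) hj
      refine ⟨W.getVert 1, by simpa using hi.2, ?_⟩
      have h1 := depth_of_isChild_succ (w := W.getVert) (i := 0) (n := W.length)
        fun j _ hj => hch j (by omega)
      have h2 := h.halt_eq (w := W.getVert) (i := 1) (n := W.length - 1)
        (fun j _ hj => hch j (by omega)) fun j _ hj => hint' j (by omega) (by omega)
      rw [Nat.add_sub_of_le hpos, W.getVert_length, h.halt_of_mem y hyB] at h2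
      rw [zero_add, W.getVert_length, W.getVert_zero] at h1
      omega
    · exfalso
      obtain ⟨c, -, hu⟩ := h.existsUnique_child _ (hint' i hi0 hi.1)
      have h1 : D.IsChild (W.getVert (i - 1)) (W.getVert i) := by
        have hadj := hfn.2 (i - 1) (by omega)
        rw [Nat.sub_add_cancel hi0] at hadj
        refine hadj.resolve_right fun hc => hmin (i - 1) (by omega) ⟨by omega, ?_⟩
        rwa [Nat.sub_add_cancel hi0]
      have := hfn.1 (by simp; omega) (by simp; omega) ((hu _ h1).trans (hu _ hi.2).symm)
      omega
  · exfalso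
    push Not at hex
    obtain ⟨P, hP⟩ := D.isTree.1.exists_isPath x D.root
    have : ∀ n ≤ W.length, W.getVert n ∈ P.support := by
      intro n hn
      induction n with
      | zero => simp
      | succ n ih =>
        exact ((hfn.2 n (by omega)).resolve_right (hex n (by omega))).mem_support hP
          (ih (by omega))
    exact hy P hP (by simpa using this W.length le_rfl)

lemma IsBranching.uniformSubdivTOmega [Countable V] (h : IsBranching D B halt)
    (hu : ∀ v ∈ B, ∀ c c', D.IsChild c v → D.IsChild c' v → halt c = halt c') :
    UniformSubdivTOmega D.graph := by
  refine ⟨h.isSubdivTOmega, D.root, h.branchVtx_iff.2 h.root_mem,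
    fun x y z W W' hW hW' hy hz => ?_⟩
  obtain ⟨c, hc, hl⟩ := h.length_eq hW hy
  obtain ⟨c', hc', hl'⟩ := h.length_eq hW' hz
  have := hu x (h.branchVtx_iff.1 hW.2.1) c c' hc hc'
  omega

end ParentTree

namespace ParentTree

variable {V : Type} {D : ParentTree V}

lemma countable_of_neighborSet (h : ∀ v, (D.graph.neighborSet v).Countable) : Countable V := by
  have h1 : ∀ n, {v | D.depth v = n}.Countable := by
    intro n
    induction n with
    | zero =>
      refine (Set.countable_singleton D.root).mono fun v hv => ?_
      by_contra hr
      have h1 := (isChild_parent hr).depth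
      rw [Set.mem_ofPred_eq] at hv
      omega
    | succ n ih =>
      refine (ih.biUnion fun v _ => h v).mono fun v hv => ?_
      rw [Set.mem_ofPred_eq] at hv
      have hr : v ≠ D.root := by
        rintro rfl
        rw [D.depth_root] at hv
        omega
      have hc := isChild_parent hr
      have := hc.depth
      exact Set.mem_biUnion (x := D.parent v) (by rw [Set.mem_ofPred_eq]; omega) hc.adj
  refine Set.countable_univ_iff.1 ((Set.countable_iUnion h1).mono fun v _ => ?_)
  exact Set.mem_iUnion.2 ⟨_, rfl⟩

lemma setOf_parent_subsingleton (v : V) : {u | D.IsChild v u}.Subsingleton :=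
  fun _ h _ h' => h.unique h'

lemma exists_isChild {v : V} (h : 2 ≤ #(D.graph.neighborSet v)) : ∃ c, D.IsChild c v := by
  by_contra! hc
  have : D.graph.neighborSet v ⊆ {u | D.IsChild v u} := by
    rw [neighborSet_eq]
    rintro u (hu | hu)
    · exact absurd hu (hc u)
    · exact hu
  have h1 := h.trans (Cardinal.mk_le_one_iff_set_subsingleton.2
    ((setOf_parent_subsingleton v).anti this))
  exact absurd h1 (by norm_num)

lemma existsUnique_isChild {v : V} (h : #(D.graph.neighborSet v) = 2) (hv : v ≠ D.root) :
    ∃! c, D.IsChild c v := by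
  obtain ⟨c, hc⟩ := exists_isChild h.ge
  refine ⟨c, hc, fun c' hc' => ?_⟩
  have hp := isChild_parent hv
  by_contra hne
  have hsub : ({c', c, D.parent v} : Set V) ⊆ D.graph.neighborSet v := by
    rw [neighborSet_eq]
    rintro u (rfl | rfl | rfl)
    · exact Or.inl hc'
    · exact Or.inl hc
    · exact Or.inr hp
  have h1 := Cardinal.mk_le_mk_of_subset hsub
  have h2 := hc.depth
  have h2' := hc'.depth
  have h3 := hp.depth
  have h4 : c ≠ D.parent v := fun he => by rw [← he] at h3; omega
  have h5 : c' ≠ D.parent v := fun he => by rw [← he] at h3; omega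
  rw [h, Cardinal.mk_insert, Cardinal.mk_insert, Cardinal.mk_singleton] at h1
  · norm_num at h1
  · exact h4
  · rintro (h | h)
    · exact hne h
    · exact h5 h

lemma infinite_isChild {v : V} (h : BranchVtx D.graph v) : {c | D.IsChild c v}.Infinite := by
  intro hfin
  have h1 : (D.graph.neighborSet v).Finite := by
    rw [neighborSet_eq]
    exact hfin.union (setOf_parent_subsingleton v).finite
  exact (Cardinal.lt_aleph0_iff_set_finite.2 h1).ne h

end ParentTree

lemma IsSubdivTOmega.countable {V : Type} {T : SimpleGraph V} (h : IsSubdivTOmega T) :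
    Countable V := by
  obtain ⟨r⟩ := h.1.1.nonempty
  obtain ⟨D, rfl, -, -⟩ := exists_parentTree h.1 r
  refine D.countable_of_neighborSet fun v => ?_
  rw [← Cardinal.le_aleph0_iff_set_countable]
  rcases h.2.1 v with h1 | h1
  · rw [h1]
    exact (Cardinal.natCast_lt_aleph0 (n := 2)).le
  · exact h1.le

lemma IsSubdivTOmega.exists_isChild {V : Type} {D : ParentTree V} (h : IsSubdivTOmega D.graph)
    (v : V) : ∃ c, D.IsChild c v := by
  refine ParentTree.exists_isChild ?_
  rcases h.2.1 v with h1 | h1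
  · exact h1.ge
  · rw [h1]
    exact (Cardinal.natCast_lt_aleph0 (n := 2)).le

lemma IsSubdivTOmega.exists_iterate {V : Type} {D : ParentTree V} (h : IsSubdivTOmega D.graph)
    {ch : V → V} (hch : ∀ v, D.IsChild (ch v) v) (v : V) :
    ∃ k, BranchVtx D.graph (ch^[k] v) :=
  h.2.2 (fun k => ch^[k] v) (ParentTree.isRay_of_isChild fun n => by
    rw [Function.iterate_succ_apply']
    exact hch _)

lemma IsSubdivTOmega.exists_branchVtx {V : Type} {T : SimpleGraph V} (h : IsSubdivTOmega T) :
    ∃ r, BranchVtx T r := by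
  obtain ⟨r⟩ := h.1.1.nonempty
  obtain ⟨D, rfl, -, -⟩ := exists_parentTree h.1 r
  choose ch hch using h.exists_isChild
  obtain ⟨k, hk⟩ := h.exists_iterate hch r
  exact ⟨_, hk⟩

/-- A subdivision of `T_ω`, rooted at a branch vertex, is the graph of a branching parent tree,
and next branch vertices are joined by subdivided edges. -/
lemma IsSubdivTOmega.exists_isBranching {V : Type} {T : SimpleGraph V} (h : IsSubdivTOmega T)
    {r : V} (hr : BranchVtx T r) :
    ∃ (D : ParentTree V) (halt : V → ℕ), D.graph = T ∧ D.root = r ∧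
      D.IsBranching {v | BranchVtx T v} halt ∧
      ∀ x c, BranchVtx T x → D.IsChild c x → ∃ (y : V) (W : D.graph.Walk x y),
        SubdividedEdge D.graph W ∧ D.depth x < D.depth y ∧ D.depth x + W.length = halt c := by
  classical
  obtain ⟨D, rfl, rfl, -⟩ := exists_parentTree h.1 r
  choose ch hch using h.exists_isChild
  have hex := h.exists_iterate hch
  have huniq : ∀ v, ¬ BranchVtx D.graph v → ∃! c, D.IsChild c v := fun v hv =>
    ParentTree.existsUnique_isChild ((h.2.1 v).resolve_right hv) fun he => hv (he ▸ hr)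
  have hhalt : ∀ v, ¬ BranchVtx D.graph v → Nat.find (hex v) = Nat.find (hex (ch v)) + 1 := by
    intro v hv
    exact Nat.find_comp_succ (hex v) (hex (ch v)) hv
  refine ⟨D, fun v => D.depth v + Nat.find (hex v), rfl, rfl, ⟨hr, huniq,
    fun v hv => ParentTree.infinite_isChild hv, ?_, fun v => Nat.le_add_right _ _, ?_⟩, ?_⟩
  · intro c v hc hv
    rw [(huniq v hv).unique hc (hch v)] at *
    have := hhalt v hv
    have := hc.depth
    omega
  · intro v hv
    have : Nat.find (hex v) = 0 := (Nat.find_eq_zero (hex v)).2 hv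
    simp [this]
  · intro x c hx hc
    let w : ℕ → V := fun n => n.casesOn x fun m => ch^[m] c
    have hw : ∀ n, D.IsChild (w (n + 1)) (w n) := by
      intro n
      cases n with
      | zero => exact hc
      | succ n =>
        change D.IsChild (ch^[n + 1] c) (ch^[n] c)
        rw [Function.iterate_succ_apply']
        exact hch _
    have hd : ∀ n, D.depth (w n) = D.depth x + n := fun n => by
      have := ParentTree.depth_of_isChild_succ (w := w) (i := 0) (n := n) fun j _ _ => hw j
      rwa [zero_add] at this
    set k := Nat.find (hex c) with hk
    have hray := ParentTree.isRay_of_isChild hw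
    obtain ⟨W, hW, hl, hs⟩ := IsPathFn.exists_walk (p := w) (ℓ := k + 1)
      ⟨hray.1.injOn, fun i _ => hray.2 i⟩
    refine ⟨w (k + 1), W, ⟨hW, hx, Nat.find_spec (hex c), by omega, ?_⟩, ?_, ?_⟩
    · intro v hv hvx hvy
      obtain ⟨i, hi, rfl⟩ := hs v hv
      cases i with
      | zero => exact absurd rfl hvx
      | succ i =>
        refine Nat.find_min (hex c) (lt_of_le_of_ne (Nat.le_of_succ_le_succ hi) ?_)
        rintro rfl
        exact hvy rfl
    · exact lt_of_lt_of_eq (b := D.depth x + (k + 1)) (by omega) (hd (k + 1)).symm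
    · have := hc.depth
      dsimp only
      omega

namespace ParentTree

variable {V : Type} {D : ParentTree V} {B : Set V} {halt : V → ℕ}

/-- Labels on the children of branch vertices extend along subdivided edges to a labelling of
the tree which dominates `g` along some ray, if each branch vertex has a child whose label
bounds `g` at the end of its subdivided edge. -/
lemma IsBranching.exists_label (h : IsBranching D B halt) (F : V → ℕ) :
    ∃ L : V → ℕ, ∀ g, Monotone g →
      (∀ x ∈ B, ∃ c, D.IsChild c x ∧ g (halt c) ≤ F c) →
      ∃ R, IsRay D.graph R ∧ EvDom g (L ∘ R) := by
  classical
  have hL : ∃ L : V → ℕ, ∀ c v, D.IsChild c v → L c = if v ∈ B then F c else L v := by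
    let Lk : ℕ → V → ℕ := fun n =>
      n.rec (fun _ => 0) fun _ l v => if D.parent v ∈ B then F v else l (D.parent v)
    refine ⟨fun v => Lk (D.depth v) v, fun c v hc => ?_⟩
    dsimp only
    rw [hc.depth, ← hc.2]
  obtain ⟨L, hL⟩ := hL
  refine ⟨L, fun g hg hc => ?_⟩
  have hnx : ∀ v, ∃ c, D.IsChild c v ∧ (v ∈ B → g (halt c) ≤ F c) := by
    intro v
    by_cases hv : v ∈ B
    · obtain ⟨c, h1, h2⟩ := hc v hv
      exact ⟨c, h1, fun _ => h2⟩
    · obtain ⟨c, h1, -⟩ := h.existsUnique_child v hv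
      exact ⟨c, h1, fun h => absurd h hv⟩
  choose nx hnx hnxF using hnx
  have hR : ∀ n, D.IsChild (nx^[n + 1] D.root) (nx^[n] D.root) := fun n => by
    rw [Function.iterate_succ_apply']
    exact hnx _
  refine ⟨fun n => nx^[n] D.root, isRay_of_isChild hR, ?_⟩
  have hinv : ∀ n, g (halt (nx^[n + 1] D.root)) ≤ L (nx^[n + 1] D.root) := by
    intro n
    induction n with
    | zero =>
      rw [hL _ _ (hR 0), Function.iterate_zero_apply, if_pos h.root_mem]
      exact hnxF _ h.root_mem
    | succ n ih =>
    rw [hL _ _ (hR _)]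
    split_ifs with hb
    · rw [Function.iterate_succ_apply']
      exact hnxF _ hb
    · rwa [h.halt_child _ _ (hR _) hb]
  filter_upwards [eventually_ge_atTop 1] with n hn
  obtain ⟨n, rfl⟩ := Nat.exists_eq_add_of_le' hn
  refine (hg ?_).trans (hinv n)
  have h1 := depth_of_isChild_succ (w := fun n => nx^[n] D.root) (i := 0) (n := n + 1)
    fun j _ _ => hR j
  have h2 := h.depth_le_halt (nx^[n + 1] D.root)
  rw [zero_add] at h1
  omega

end ParentTree

/-- A uniform subdivision of `T_ω` is dominating. -/
lemma UniformSubdivTOmega.exists_label {V : Type} {T : SimpleGraph V}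
    (h : UniformSubdivTOmega T) :
    ∃ L : V → ℕ, ∀ g, Monotone g → ∃ R, IsRay T R ∧ EvDom g (L ∘ R) := by
  obtain ⟨hT, r, hr, hunif⟩ := h
  have := hT.countable
  obtain ⟨enc, henc⟩ := exists_injective_nat V
  obtain ⟨D, halt, rfl, rfl, hB, hW⟩ := hT.exists_isBranching hr
  obtain ⟨L, hL⟩ := hB.exists_label enc
  refine ⟨L, fun g hg => hL g hg fun x hx => ?_⟩
  have hinf := hB.infinite_children x hx
  obtain ⟨c₀, hc₀⟩ := hinf.nonempty
  obtain ⟨y₀, W₀, hW₀, hy₀, hl₀⟩ := hW x c₀ hx hc₀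
  obtain ⟨_, ⟨c, hc, rfl⟩, hlt⟩ :=
    (hinf.image henc.injOn).exists_gt (g (halt c₀))
  refine ⟨c, hc, ?_⟩
  obtain ⟨y, W, hW, hy, hl⟩ := hW x c hx hc
  have hlen := hunif x y y₀ W W₀ hW hW₀
    (fun P hP hmem => (ParentTree.depth_le_of_mem_support hP hmem).not_gt hy)
    (fun P hP hmem => (ParentTree.depth_le_of_mem_support hP hmem).not_gt hy₀)
  rw [show halt c = halt c₀ by omega]
  exact hlt.le

/-- A subdivision of `T_ω` can be labelled so that its rays dominate every function that does
not dominate a given function. -/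
lemma IsSubdivTOmega.exists_label {V : Type} {T : SimpleGraph V} (hT : IsSubdivTOmega T)
    {f : ℕ → ℕ} (hf : Monotone f) :
    ∃ L : V → ℕ, ∀ g, Monotone g → ¬ EvDom f g → ∃ R, IsRay T R ∧ EvDom g (L ∘ R) := by
  classical
  obtain ⟨r, hr⟩ := hT.exists_branchVtx
  have : Nonempty V := ⟨r⟩
  have := hT.countable
  obtain ⟨enc, henc⟩ := exists_injective_nat V
  obtain ⟨D, halt, rfl, rfl, hB, -⟩ := hT.exists_isBranching hr
  have hc : ∀ x n, ∃ c, BranchVtx D.graph x → D.IsChild c x ∧ n ≤ enc c := by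
    intro x n
    by_cases hx : BranchVtx D.graph x
    · obtain ⟨_, ⟨c, hc, rfl⟩, hlt⟩ :=
        ((hB.infinite_children x hx).image henc.injOn).exists_gt n
      exact ⟨c, fun _ => ⟨hc, hlt.le⟩⟩
    · exact ⟨x, fun h => absurd h hx⟩
  choose c hc using hc
  let M : ℕ → ℕ := fun n => n + ∑ q ∈ Finset.range (n + 1) ×ˢ Finset.range (n + 1),
    halt (c (Function.invFun enc q.1) q.2)
  have hM : Monotone M := fun a b hab => Nat.add_le_add hab
    (Finset.sum_le_sum_of_subset (Finset.product_subset_product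
      (Finset.range_subset_range.2 (by omega)) (Finset.range_subset_range.2 (by omega))))
  have hMhalt : ∀ x n, enc x ≤ n → halt (c x n) ≤ M n := by
    intro x n hx
    have h1 := Finset.single_le_sum (f := fun q : ℕ × ℕ => halt (c (Function.invFun enc q.1) q.2))
      (s := Finset.range (n + 1) ×ˢ Finset.range (n + 1)) (fun _ _ => Nat.zero_le _)
      (a := (enc x, n)) (by simp; omega)
    rw [Function.leftInverse_invFun henc x] at h1
    exact h1.trans (Nat.le_add_left _ _)
  obtain ⟨L, hL⟩ := hB.exists_label fun v => f (M (enc v + 1))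
  refine ⟨L, fun g hg hfg => hL g hg fun x hx => ?_⟩
  obtain ⟨m, hm, hgm⟩ := (Filter.frequently_atTop.1 (Filter.not_eventually.1 hfg)) (M (enc x))
  have hex : ∃ n, m < M n := ⟨m + 1, Nat.lt_of_lt_of_le m.lt_succ_self (Nat.le_add_right _ _)⟩
  obtain ⟨n, hn⟩ : ∃ n, Nat.find hex = n + 1 := by
    refine Nat.exists_eq_succ_of_ne_zero fun h0 => ?_
    have h1 := Nat.find_spec hex
    rw [h0] at h1
    exact absurd (h1.trans_le (hM (Nat.zero_le _))) (not_lt.2 hm)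
  have hspec : m < M (n + 1) := hn ▸ Nat.find_spec hex
  have hmin : M n ≤ m := not_lt.1 (Nat.find_min hex (by omega))
  have hxn : enc x ≤ n := by
    by_contra hlt
    exact absurd (hspec.trans_le (hM (show n + 1 ≤ enc x by omega))) (not_lt.2 hm)
  obtain ⟨hch, hle⟩ := hc x n hx
  refine ⟨c x n, hch, ?_⟩
  calc g (halt (c x n)) ≤ g m := hg ((hMhalt x n hxn).trans hmin)
    _ ≤ f m := (not_le.1 hgm).le
    _ ≤ f (M (enc (c x n) + 1)) := hf (hspec.le.trans (hM (by omega)))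

lemma exists_monotone_ge (f : ℕ → ℕ) : ∃ g, Monotone g ∧ ∀ n, f n ≤ g n :=
  ⟨fun n => ∑ i ∈ Finset.range (n + 1), f i,
    fun _ _ hab => Finset.sum_le_sum_of_subset (Finset.range_subset_range.2 (by omega)),
    fun n => Finset.single_le_sum (fun _ _ => Nat.zero_le _) (by simp)⟩

lemma exists_glue {X ι : Type} {H : ι → Set X} (hH : Pairwise (Function.onFun Disjoint H))
    (L : ∀ i, H i → ℕ) : ∃ L' : X → ℕ, ∀ i (v : H i), L' v = L i v := by
  classical
  refine ⟨fun v => if h : ∃ i, v ∈ H i then L h.choose ⟨v, h.choose_spec⟩ else 0,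
    fun i v => ?_⟩
  have h : ∃ j, (v : X) ∈ H j := ⟨i, v.2⟩
  have hi : h.choose = i := by
    by_contra hne
    exact Set.disjoint_left.1 (hH hne) h.choose_spec v.2
  dsimp only
  rw [dif_pos h]
  have : ∀ j (hj : j = i) (hv : (v : X) ∈ H j), L j ⟨v, hv⟩ = L i v := by
    rintro j rfl hv
    rfl
  exact this _ hi _

lemma IsRay.of_le_induce {X : Type} {G : SimpleGraph X} {s : Set X} {T : SimpleGraph s}
    (hT : T ≤ G.induce s) {R : ℕ → s} (hR : IsRay T R) : IsRay G (fun n => (R n : X)) :=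
  ⟨Subtype.val_injective.comp hR.1, fun n => hT (hR.2 n)⟩

/-- To show that a graph is dominating it suffices to dominate monotone functions. -/
lemma dominatingGraph_of_monotone {X : Type} {G : SimpleGraph X} (L : X → ℕ)
    (h : ∀ g, Monotone g → ∃ R, IsRay G R ∧ EvDom g (L ∘ R)) : DominatingGraph G := by
  refine ⟨L, fun f => ?_⟩
  obtain ⟨g, hg, hfg⟩ := exists_monotone_ge f
  obtain ⟨R, hR, hdom⟩ := h g hg
  exact ⟨R, hR, hdom.mono fun n hn => (hfg n).trans hn⟩

lemma dominatingGraph_of_uniform {X : Type} {G : SimpleGraph X} {s : Set X} {T : SimpleGraph s}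
    (hT : T ≤ G.induce s) (h : UniformSubdivTOmega T) : DominatingGraph G := by
  obtain ⟨L, hL⟩ := h.exists_label
  obtain ⟨L', hL'⟩ := exists_glue (ι := Unit) (H := fun _ => s)
    (fun i j hij => absurd (Subsingleton.elim i j) hij) fun _ => L
  refine dominatingGraph_of_monotone L' fun g hg => ?_
  obtain ⟨R, hR, hdom⟩ := hL g hg
  exact ⟨_, hR.of_le_induce hT, hdom.mono fun n hn => hn.trans (hL' () (R n)).ge⟩

lemma dominatingGraph_of_disjoint_subdivisions {X ι : Type} {G : SimpleGraph X}
    (hι : #ι = bNum) {H : ι → Set X} (hH : Pairwise (Function.onFun Disjoint H))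
    (h : ∀ i, ∃ T : SimpleGraph (H i), T ≤ G.induce (H i) ∧ IsSubdivTOmega T) :
    DominatingGraph G := by
  obtain ⟨F, hF, hFc⟩ := exists_not_bddFamily
  obtain ⟨e⟩ := Cardinal.eq.1 (hι.trans hFc.symm)
  choose T hTG hT using h
  choose f hf hef using fun i => exists_monotone_ge (e i : ℕ → ℕ)
  choose L hL using fun i => (hT i).exists_label (hf i)
  obtain ⟨L', hL'⟩ := exists_glue hH L
  refine dominatingGraph_of_monotone L' fun g hg => ?_
  obtain ⟨k, hk, hkg⟩ : ∃ k ∈ F, ¬ EvDom k g := by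
    by_contra! hc
    exact hF ⟨g, hc⟩
  obtain ⟨i, hi⟩ := e.surjective ⟨k, hk⟩
  obtain ⟨R, hR, hdom⟩ := hL i g hg fun hc => hkg <| hc.mono fun n hn => by
    have := hef i n
    rw [hi] at this
    exact this.trans hn
  exact ⟨_, hR.of_le_induce (hTG i), hdom.mono fun n hn => hn.trans (hL' i (R n)).ge⟩

lemma dominatingGraph_of_disjoint_rays {X ι : Type} {G : SimpleGraph X}
    (hι : #ι = dNum) {R : ι → ℕ → X} (hR : ∀ i, IsRay G (R i))
    (hdisj : Pairwise fun i j => Disjoint (Set.range (R i)) (Set.range (R j))) :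
    DominatingGraph G := by
  obtain ⟨F, hF, hFc⟩ := exists_domFamily
  obtain ⟨e⟩ := Cardinal.eq.1 (hι.trans hFc.symm)
  obtain ⟨L, hL⟩ := exists_glue hdisj fun i v => (e i : ℕ → ℕ) v.2.choose
  refine ⟨L, fun g => ?_⟩
  obtain ⟨k, hk, hgk⟩ := hF g
  obtain ⟨i, hi⟩ := e.surjective ⟨k, hk⟩
  refine ⟨R i, hR i, hgk.mono fun n hn => ?_⟩
  have h1 : (⟨R i n, n, rfl⟩ : Set.range (R i)).2.choose = n :=
    (hR i).1 (⟨R i n, n, rfl⟩ : Set.range (R i)).2.choose_spec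
  have h2 := hL i ⟨R i n, n, rfl⟩
  rw [h1, hi] at h2
  exact hn.trans h2.ge

namespace ParentTree

variable {V V' : Type}

/-- Transport of a parent tree along a bijection. -/
def transport (D : ParentTree V) (e : V ≃ V') : ParentTree V' where
  root := e D.root
  parent v := e (D.parent (e.symm v))
  depth v := D.depth (e.symm v)
  depth_root := by rw [e.symm_apply_apply, D.depth_root]
  depth_parent v hv := by
    rw [e.symm_apply_apply]
    exact D.depth_parent _ fun h => hv ((e.symm_apply_eq).1 h)

lemma transport_isChild {D : ParentTree V} {e : V ≃ V'} {c v : V'} :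
    (D.transport e).IsChild c v ↔ D.IsChild (e.symm c) (e.symm v) := by
  unfold IsChild transport
  rw [Ne, Ne, Equiv.symm_apply_eq, Equiv.eq_symm_apply]

lemma IsBranching.transport {D : ParentTree V} {B : Set V} {halt : V → ℕ}
    (h : D.IsBranching B halt) (e : V ≃ V') :
    (D.transport e).IsBranching (e.symm ⁻¹' B) (halt ∘ e.symm) where
  root_mem := by
    change e.symm (e D.root) ∈ B
    rw [e.symm_apply_apply]
    exact h.root_mem
  existsUnique_child v hv := by
    simp_rw [transport_isChild]
    obtain ⟨c, hc, hu⟩ := h.existsUnique_child _ hv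
    refine ⟨e c, by simpa using hc, fun c' hc' => ?_⟩
    rw [← hu _ hc', e.apply_symm_apply]
  infinite_children v hv := by
    simp_rw [transport_isChild]
    exact (h.infinite_children _ hv).preimage (by simp)
  halt_child c v hc hv := h.halt_child _ _ (transport_isChild.1 hc) hv
  depth_le_halt v := h.depth_le_halt _
  halt_of_mem v hv := h.halt_of_mem _ hv

end ParentTree

/-- The index of the segment from which segment `n` of a segment tree branches off. -/
def segParent (n : ℕ) : ℕ := (Nat.unpair (n - 1)).1

lemma segParent_lt {n : ℕ} (hn : n ≠ 0) : segParent n < n :=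
  (Nat.unpair_left_le _).trans_lt (by omega)

/-- The depth of the first vertex of a segment, given the lengths of the segments. -/
def segStart (len : ℕ → ℕ) (n : ℕ) : ℕ :=
  if h : n = 0 then 0 else
    have := segParent_lt h
    segStart len (segParent n) + len (segParent n) + 1
termination_by n

/-- The vertices of the tree obtained by attaching, for each `n ≠ 0`, a path with `len n + 1`
vertices to the end of segment `segParent n`. -/
abbrev SegVertex (len : ℕ → ℕ) : Type := {q : ℕ × ℕ // q.2 ≤ len q.1}

/-- The tree obtained by attaching, for each `n ≠ 0`, a path with `len n + 1` vertices to the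
end of segment `segParent n`. -/
def segTree (len : ℕ → ℕ) : ParentTree (SegVertex len) where
  root := ⟨(0, 0), Nat.zero_le _⟩
  parent v := if v.1.2 = 0 then ⟨(segParent v.1.1, len (segParent v.1.1)), le_rfl⟩
    else ⟨(v.1.1, v.1.2 - 1), (Nat.sub_le _ _).trans v.2⟩
  depth v := segStart len v.1.1 + v.1.2
  depth_root := by
    rw [segStart]
    rfl
  depth_parent := by
    rintro ⟨⟨n, i⟩, hi⟩ hne
    dsimp only at hi ⊢
    split_ifs with h
    · subst h
      have hn : n ≠ 0 := by
        rintro rfl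
        exact hne rfl
      rw [segStart, dif_neg hn]
    · change segStart len n + i = segStart len n + (i - 1) + 1
      omega

lemma segTree_isChild {len : ℕ → ℕ} {c v : SegVertex len} :
    (segTree len).IsChild c v ↔
      (c.1.2 = 0 ∧ c.1.1 ≠ 0 ∧ segParent c.1.1 = v.1.1 ∧ v.1.2 = len v.1.1) ∨
      (c.1.1 = v.1.1 ∧ c.1.2 = v.1.2 + 1) := by
  obtain ⟨⟨n, i⟩, hi⟩ := c
  obtain ⟨⟨m, j⟩, hj⟩ := v
  unfold ParentTree.IsChild segTree
  dsimp only at hi hj ⊢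
  rw [Ne, Subtype.mk.injEq, Prod.mk.injEq]
  split_ifs with h
  · rw [Subtype.mk.injEq, Prod.mk.injEq]
    constructor
    · rintro ⟨h1, rfl, rfl⟩
      exact Or.inl ⟨h, fun hn => h1 ⟨hn, h⟩, rfl, rfl⟩
    · rintro (⟨_, h1, rfl, rfl⟩ | ⟨_, h2⟩)
      · exact ⟨fun hn => h1 hn.1, rfl, rfl⟩
      · omega
  · rw [Subtype.mk.injEq, Prod.mk.injEq]
    omega

lemma segTree_isBranching (len : ℕ → ℕ) (h0 : len 0 = 0) :
    (segTree len).IsBranching {v | v.1.2 = len v.1.1}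
      (fun v => segStart len v.1.1 + len v.1.1) where
  root_mem := h0.symm
  existsUnique_child := by
    rintro ⟨⟨n, i⟩, hi⟩ hv
    simp_rw [segTree_isChild]
    have hlt : i < len n := lt_of_le_of_ne hi hv
    refine ⟨⟨(n, i + 1), hlt⟩, Or.inr ⟨rfl, rfl⟩, ?_⟩
    rintro ⟨⟨m, j⟩, hj⟩ (⟨_, _, _, h⟩ | ⟨h1, h2⟩)
    · exact absurd h hv
    · exact Subtype.ext (Prod.ext h1 h2)
  infinite_children := by
    rintro ⟨⟨n, i⟩, hi⟩ hv
    simp_rw [segTree_isChild]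
    refine Set.infinite_of_injective_forall_mem
      (f := fun k => ⟨(Nat.pair n k + 1, 0), Nat.zero_le _⟩) (fun a b hab => ?_) fun k =>
        Or.inl ⟨rfl, Nat.succ_ne_zero _, ?_, hv⟩
    · have h1 := congrArg (fun v : SegVertex len => v.1.1) hab
      dsimp only at h1
      exact (Nat.pair_eq_pair.1 (Nat.succ_injective h1)).2
    · simp [segParent]
  halt_child := by
    intro c v hc hv
    rcases segTree_isChild.1 hc with ⟨_, _, _, h⟩ | ⟨h1, h2⟩
    · exact absurd h hv
    · rw [h1]
  depth_le_halt v := Nat.add_le_add_left v.2 _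
  halt_of_mem v hv := by
    change segStart len v.1.1 + len v.1.1 = segStart len v.1.1 + v.1.2
    rw [Set.mem_ofPred_eq] at hv
    rw [hv]

/-- Recursive construction of a sequence, where the condition on each term depends on all
earlier terms. -/
lemma exists_seq_of_step {α : Type} [Inhabited α] (Q : ℕ → (ℕ → α) → Prop)
    (congr : ∀ n h h', (∀ m ≤ n, h m = h' m) → Q n h → Q n h')
    (step : ∀ n h, (∀ m < n, Q m h) → ∃ a, Q n (Function.update h n a)) :
    ∃ h, ∀ n, Q n h := by
  choose! nxt hnxt using step
  let H : ℕ → ℕ → α := fun n =>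
    n.rec (fun _ => default) fun n h => Function.update h n (nxt n h)
  have hH : ∀ n, H (n + 1) = Function.update (H n) n (nxt n (H n)) := fun _ => rfl
  have hstab : ∀ m k, H (m + 1 + k) m = H (m + 1) m := by
    intro m k
    induction k with
    | zero => rfl
    | succ k ih =>
      rw [← add_assoc, hH, Function.update_of_ne (by omega), ih]
  have hlt : ∀ m n, m < n → H n m = H (m + 1) m := by
    intro m n hmn
    obtain ⟨k, rfl⟩ := Nat.exists_eq_add_of_le (Nat.succ_le_of_lt hmn)
    exact hstab m k
  refine ⟨fun n => H (n + 1) n, fun n => ?_⟩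
  induction n using Nat.strong_induction_on with
  | _ n ih =>
  refine congr n (H (n + 1)) _ (fun m hm => hlt m (n + 1) (by omega)) ?_
  rw [hH]
  exact hnxt n _ fun m hm =>
    congr m (fun n => H (n + 1) n) (H n) (fun j hj => (hlt j n (by omega)).symm) (ih m hm)

/-- The condition on the `n`-th segment `h n`, given as a length and a path function, of a copy of
a segment tree in `G` whose segments end in `W` and have lengths prescribed by `D`. -/
def SegCond {X : Type} (G : SimpleGraph X) (D : X → Set ℕ) (W : Set X) (n : ℕ)
    (h : ℕ → ℕ × (ℕ → X)) : Prop :=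
  (h n).2 (h n).1 ∈ W ∧ IsPathFn G (h n).2 (h n).1 ∧ (n = 0 → (h n).1 = 0) ∧
  (n ≠ 0 → G.Adj ((h (segParent n)).2 (h (segParent n)).1) ((h n).2 0) ∧
    (h n).1 + 1 ∈ D ((h (segParent n)).2 (h (segParent n)).1)) ∧
  ∀ m < n, ∀ i ≤ (h m).1, ∀ j ≤ (h n).1, (h m).2 i ≠ (h n).2 j

lemma exists_segments {X : Type} {G : SimpleGraph X} {D : X → Set ℕ} {W : Set X}
    (hne : W.Nonempty) (hW : ∀ x ∈ W, Escapes G (D x) W x) :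
    ∃ h, ∀ n, SegCond G D W n h := by
  classical
  obtain ⟨x₀, hx₀⟩ := hne
  have : Inhabited (ℕ × (ℕ → X)) := ⟨(0, fun _ => x₀)⟩
  refine exists_seq_of_step _ ?_ ?_
  · intro n h h' heq hQ
    have h1 := heq n le_rfl
    have h2 : n ≠ 0 → h (segParent n) = h' (segParent n) := fun hn =>
      heq _ (segParent_lt hn).le
    unfold SegCond at hQ ⊢
    rw [h1] at hQ
    refine ⟨hQ.1, hQ.2.1, hQ.2.2.1, fun hn => h2 hn ▸ hQ.2.2.2.1 hn, fun m hm => ?_⟩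
    rw [← heq m hm.le]
    exact hQ.2.2.2.2 m hm
  · intro n h hprev
    by_cases hn : n = 0
    · subst hn
      refine ⟨(0, fun _ => x₀), ?_⟩
      unfold SegCond
      rw [Function.update_self]
      exact ⟨hx₀, ⟨fun a ha b hb _ => (Nat.le_zero.1 ha).trans (Nat.le_zero.1 hb).symm, by simp⟩,
        fun _ => rfl, fun h => absurd rfl h, by simp⟩
    · set x := (h (segParent n)).2 (h (segParent n)).1 with hx
      obtain ⟨p, ℓ, hℓ0, hℓD, hp, hp0, hpW, hpS⟩ := hW x (hprev _ (segParent_lt hn)).1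
        ((Finset.range n).biUnion fun m => (Finset.range ((h m).1 + 1)).image (h m).2)
      refine ⟨(ℓ - 1, fun i => p (i + 1)), ?_⟩
      unfold SegCond
      rw [Function.update_self, Function.update_of_ne (segParent_lt hn).ne]
      have hℓ : ℓ - 1 + 1 = ℓ := by omega
      refine ⟨by simpa [hℓ] using hpW, ⟨?_, fun i hi => hp.2 (i + 1) (by dsimp only at hi; omega)⟩,
        fun h => absurd h hn, fun _ => ⟨?_, by simpa [hℓ] using hℓD⟩, ?_⟩
      · intro a ha b hb hab
        simp only [Set.mem_Iic] at ha hb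
        have := hp.1 (by simp; omega) (by simp; omega) hab
        omega
      · have := hp.2 0 hℓ0
        rwa [hp0] at this
      · intro m hm i hi j hj he
        rw [Function.update_of_ne hm.ne] at hi he
        refine hpS (j + 1) (by omega) (by dsimp only at hj; omega) ?_
        rw [Finset.mem_biUnion]
        exact ⟨m, Finset.mem_range.2 hm, Finset.mem_image.2
          ⟨i, Finset.mem_range.2 (by omega), he⟩⟩

/-- A set whose vertices cannot be finitely separated from it gives rise to a subdivision of
`T_ω`, which is uniform if only one length is allowed at each vertex. -/
lemma exists_subdivision {X : Type} {G : SimpleGraph X} {D : X → Set ℕ} {W : Set X}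
    (hne : W.Nonempty) (hW : ∀ x ∈ W, Escapes G (D x) W x) :
    ∃ (s : Set X) (T : SimpleGraph s), T ≤ G.induce s ∧ IsSubdivTOmega T ∧
      ((∀ x, (D x).Subsingleton) → UniformSubdivTOmega T) := by
  obtain ⟨h, hQ⟩ := exists_segments hne hW
  let len : ℕ → ℕ := fun n => (h n).1
  have h0 : len 0 = 0 := (hQ 0).2.2.1 rfl
  let φ : SegVertex len → X := fun v => (h v.1.1).2 v.1.2
  have hφ : Function.Injective φ := by
    rintro ⟨⟨n, i⟩, hi⟩ ⟨⟨m, j⟩, hj⟩ he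
    rcases lt_trichotomy n m with hlt | rfl | hlt
    · exact absurd he ((hQ m).2.2.2.2 n hlt i hi j hj)
    · obtain rfl := (hQ n).2.1.1 hi hj he
      rfl
    · exact absurd he.symm ((hQ n).2.2.2.2 m hlt j hj i hi)
  have hadj : ∀ c v, (segTree len).IsChild c v → G.Adj (φ v) (φ c) := by
    rintro ⟨⟨n, i⟩, hi⟩ ⟨⟨m, j⟩, hj⟩ hc
    rcases segTree_isChild.1 hc with ⟨h1, h2, h3, h4⟩ | ⟨h1, h2⟩
    · dsimp only at h1 h2 h3 h4
      subst h1 h3 h4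
      exact ((hQ n).2.2.2.1 h2).1
    · dsimp only at h1 h2
      subst h1 h2
      exact (hQ n).2.1.2 j hi
  let e := Equiv.ofInjective φ hφ
  have hφe : ∀ v, φ (e.symm v) = v := fun v => Equiv.apply_ofInjective_symm hφ v
  have hB := (segTree_isBranching len h0).transport e
  have : Countable (Set.range φ) := e.symm.injective.countable
  refine ⟨Set.range φ, ((segTree len).transport e).graph, ?_, hB.isSubdivTOmega,
    fun hD => hB.uniformSubdivTOmega ?_⟩
  · rintro u v (huv | huv)
    · have := hadj _ _ (ParentTree.transport_isChild.1 huv)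
      rw [hφe, hφe] at this
      exact this.symm
    · have := hadj _ _ (ParentTree.transport_isChild.1 huv)
      rwa [hφe, hφe] at this
  · intro v hv c c' hc hc'
    rw [ParentTree.transport_isChild, segTree_isChild] at hc hc'
    rw [Set.mem_preimage, Set.mem_ofPred_eq] at hv
    generalize e.symm v = a at hv hc hc'
    have key : ∀ b : SegVertex len, (b.1.2 = 0 ∧ b.1.1 ≠ 0 ∧ segParent b.1.1 = a.1.1 ∧
        a.1.2 = len a.1.1) ∨ (b.1.1 = a.1.1 ∧ b.1.2 = a.1.2 + 1) →
        len b.1.1 + 1 ∈ D ((h a.1.1).2 (h a.1.1).1) ∧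
          segStart len b.1.1 = segStart len a.1.1 + len a.1.1 + 1 := by
      rintro b (⟨-, h1, h2, -⟩ | ⟨h1, h2⟩)
      · refine ⟨?_, by rw [segStart, dif_neg h1, ← h2]⟩
        have := ((hQ b.1.1).2.2.2.1 h1).2
        rwa [h2] at this
      · have := b.2
        rw [h1] at this
        omega
    obtain ⟨k1, k2⟩ := key _ hc
    obtain ⟨k1', k2'⟩ := key _ hc'
    have := hD _ k1 k1'
    dsimp only [Function.comp]
    omega

/-- Removing all edges at the vertices of `U`. -/
def isolate {X : Type} (G : SimpleGraph X) (U : Set X) : SimpleGraph X where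
  Adj a b := G.Adj a b ∧ a ∉ U ∧ b ∉ U
  symm := ⟨fun _ _ h => ⟨h.1.symm, h.2.2, h.2.1⟩⟩
  loopless := ⟨fun _ h => G.loopless.irrefl _ h.1⟩

lemma isolate_le {X : Type} {G : SimpleGraph X} {U : Set X} : isolate G U ≤ G :=
  fun _ _ h => h.1

/-- If every nonempty set `W` has a vertex that can be finitely separated from `W` with respect to
paths with lengths from any set in `𝒟`, then the vertices can
be ranked so that each is finitely separated from those of at least its rank. -/
lemma exists_rank_of_not_escapes {X : Type} {G : SimpleGraph X} {𝒟 : Set (Set ℕ)}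
    (h : ∀ (D : X → Set ℕ) (W : Set X), (∀ x, D x ∈ 𝒟) → (∀ x ∈ W, Escapes G (D x) W x) →
      W = ∅) :
    ∃ ρ : X → Ordinal.{0}, ∀ x, ∀ E ∈ 𝒟, ¬ Escapes G E {y | ρ x ≤ ρ y} x := by
  obtain ⟨ρ, hρ⟩ := exists_rank (fun W => {x | ∃ E ∈ 𝒟, Escapes G E W x}) (by
    classical
    intro W hW
    by_contra hne
    obtain ⟨x₀, hx₀⟩ := Set.nonempty_iff_ne_empty.2 hne
    obtain ⟨E₀, hE₀, -⟩ := hW hx₀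
    have hW' : ∀ x, ∃ E ∈ 𝒟, x ∈ W → Escapes G E W x := by
      intro x
      by_cases hx : x ∈ W
      · obtain ⟨E, hE, hEx⟩ := hW hx
        exact ⟨E, hE, fun _ => hEx⟩
      · exact ⟨E₀, hE₀, fun h => absurd h hx⟩
    choose D hD hDW using hW'
    exact hne (h D W hD hDW))
  exact ⟨ρ, fun x E hE hx => hρ x ⟨E, hE, hx⟩⟩

lemma IsSubdivTOmega.exists_adj {V : Type} {T : SimpleGraph V} (h : IsSubdivTOmega T) (v : V) :
    ∃ u, T.Adj v u := by
  have : #(T.neighborSet v) ≠ 0 := by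
    rcases h.2.1 v with h | h
    · rw [h]
      exact two_ne_zero
    · rw [show #(T.neighborSet v) = ℵ₀ from h]
      exact aleph0_ne_zero
  obtain ⟨u⟩ := mk_ne_zero_iff.1 this
  exact ⟨u, u.2⟩

/-- A dominating graph with neither a uniform subdivision of `T_ω` nor `𝔟` disjoint subdivisions
of `T_ω` contains `𝔡` disjoint rays. -/
lemma exists_disjoint_rays_of_dominatingGraph {X : Type} {G : SimpleGraph X}
    (hG : DominatingGraph G)
    (h₁ : ¬ ∃ (s : Set X) (T : SimpleGraph s), T ≤ G.induce s ∧ UniformSubdivTOmega T)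
    (h₂ : ¬ ∃ (ι : Type) (_ : #ι = bNum) (H : ι → Set X),
      Pairwise (Function.onFun Disjoint H) ∧
      ∀ i, ∃ T : SimpleGraph (H i), T ≤ G.induce (H i) ∧ IsSubdivTOmega T) :
    ∃ (ι : Type) (_ : #ι = dNum) (R : ι → ℕ → X), (∀ i, IsRay G (R i)) ∧
      Pairwise fun i j => Disjoint (Set.range (R i)) (Set.range (R j)) := by
  obtain ⟨L, hL⟩ := hG
  obtain ⟨U, hU, hUmeet⟩ := (exists_disjoint_or_hitting
    (fun A => ∃ T : SimpleGraph A, T ≤ G.induce A ∧ IsSubdivTOmega T)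
    (by
      rintro A ⟨T, -, hT⟩
      have := hT.1.1.nonempty
      exact Set.nonempty_coe_sort.1 this)
    (by
      rintro A ⟨T, -, hT⟩
      exact hT.countable) bNum aleph0_lt_bNum).resolve_left h₂
  obtain ⟨ρ, hρ⟩ := exists_rank_of_not_escapes (G := G) (𝒟 := Set.range fun ℓ => {ℓ}) (by
    intro D W hD hW
    by_contra hne
    obtain ⟨s, T, hTG, -, hT⟩ := exists_subdivision (Set.nonempty_iff_ne_empty.2 hne) hW
    refine h₁ ⟨s, T, hTG, hT fun x => ?_⟩
    obtain ⟨ℓ, hℓ⟩ := hD x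
    rw [← hℓ]
    exact Set.subsingleton_singleton)
  obtain ⟨f₀, hf₀⟩ := exists_forcing_finite_inter G ρ (fun x ℓ => hρ x _ ⟨ℓ, rfl⟩) L U hU
  obtain ⟨σ, hσ⟩ := exists_rank_of_not_escapes (G := isolate G U) (𝒟 := {Set.univ}) (by
    intro D W hD hW
    by_contra hne
    obtain ⟨s, T, hTG, hT, -⟩ := exists_subdivision (Set.nonempty_iff_ne_empty.2 hne) hW
    obtain ⟨x, hxs, hxU⟩ := hUmeet s ⟨T, hTG.trans fun _ _ h => h.1, hT⟩
    obtain ⟨u, hu⟩ := hT.exists_adj ⟨x, hxs⟩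
    exact (hTG hu).2.1 hxU)
  rcases exists_disjoint_or_hitting (fun A => ∃ R, IsRay (isolate G U) R ∧ A = Set.range R)
    (by
      rintro _ ⟨R, -, rfl⟩
      exact Set.range_nonempty R)
    (by
      rintro _ ⟨R, -, rfl⟩
      exact Set.countable_range R) dNum aleph0_lt_dNum with ⟨ι, hι, H, hH, hR⟩ | ⟨U', hU', hmeet⟩
  · choose R hR hHR using hR
    obtain rfl : H = fun i => Set.range (R i) := funext hHR
    exact ⟨ι, hι, R, fun i => ⟨(hR i).1, fun n => isolate_le ((hR i).2 n)⟩, hH⟩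
  · obtain ⟨f₁, hf₁⟩ := exists_not_dominated (isolate G U) σ (fun x => hσ x _ rfl) L U' hU' (by
      intro R hR
      obtain ⟨_, ⟨n, rfl⟩, hn⟩ := hmeet _ ⟨R, hR, rfl⟩
      exact ⟨n, hn⟩)
    obtain ⟨f, hf, hfle⟩ := exists_monotone_ge fun n => f₀ n + 1 + f₁ n
    obtain ⟨R, hR, hdom⟩ := hL f
    obtain ⟨n₀, hn₀⟩ := hf₀ R hR (hdom.mono fun n hn =>
      ((Nat.le_add_right _ _).trans (hfle n)).trans hn)
    refine absurd ?_ (hf₁ f hf (fun n => by have := hfle n; omega) (fun i => R (n₀ + i))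
      ⟨(hR.comp_add n₀).1, fun i => ⟨hR.2 (n₀ + i), hn₀ _ (by omega), hn₀ _ (by omega)⟩⟩)
    have h1 := (tendsto_add_atTop_nat n₀).eventually hdom
    refine h1.mono fun n hn => (hf (Nat.le_add_right n n₀)).trans ?_
    simpa [add_comm] using hn

/-- A graph is dominating iff it contains a uniform subdivision of `T_ω`, or 𝔟 disjoint
subdivisions of `T_ω`, or 𝔡 disjoint rays. -/
theorem stmt15 {X : Type} (G : SimpleGraph X) :
    DominatingGraph G ↔
      (∃ (s : Set X) (T : SimpleGraph s), T ≤ G.induce s ∧ UniformSubdivTOmega T) ∨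
      (∃ (ι : Type) (_ : #ι = bNum) (H : ι → Set X),
        Pairwise (Function.onFun Disjoint H) ∧
        ∀ i, ∃ T : SimpleGraph (H i), T ≤ G.induce (H i) ∧ IsSubdivTOmega T) ∨
      (∃ (ι : Type) (_ : #ι = dNum) (R : ι → ℕ → X), (∀ i, IsRay G (R i)) ∧
        Pairwise fun i j => Disjoint (Set.range (R i)) (Set.range (R j))) := by
  constructor
  · intro hG
    by_cases h₁ : ∃ (s : Set X) (T : SimpleGraph s), T ≤ G.induce s ∧ UniformSubdivTOmega T
    · exact Or.inl h₁
    · exact Or.inr (or_iff_not_imp_left.2 (exists_disjoint_rays_of_dominatingGraph hG h₁))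
  · rintro (⟨s, T, hTG, hT⟩ | ⟨ι, hι, H, hH, hT⟩ | ⟨ι, hι, R, hR, hdisj⟩)
    · exact dominatingGraph_of_uniform hTG hT
    · exact dominatingGraph_of_disjoint_subdivisions hι hH hT
    · exact dominatingGraph_of_disjoint_rays hι hR hdisj
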